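/- Let χ satisfy M_{(p₁,p₂)}(χ) < ∞ for all p₁, p₂ ≤ 2. Let f : ℝ² → ℝ be bounded, B-continuous, B-differentiable at every point of ℝ², and suppose its B-derivative D_B f is bounded on ℝ². Then for every w > 0, every (x,y) ∈ ℝ² and every δ₁, δ₂ > 0, |K_w^χ(f; x,y) − f(x,y)| ≤ D · (3 ‖D_B f‖_∞ + ω_B(D_B f; δ₁, δ₂)) + [E/δ₁ + F/δ₂ + G/(δ₁ δ₂)] · ω_B(D_B f; δ₁, δ₂), where D := (1/(4w²)) [M_{(0,0)}(χ) + 2 M_{(1,0)}(χ) + 2 M_{(0,1)}(χ) + 4 M_{(1,1)}(χ)], E := (1/(6w³)) [M_{(0,0)}(χ) + 3 M_{(2,0)}(χ) + 3 M_{(1,0)}(χ) + 2 M_{(0,1)}(χ) + 6 M_{(2,1)}(χ) + 6 M_{(1,1)}(χ)], F := (1/(6w³)) [M_{(0,0)}(χ) + 3 M_{(0,2)}(χ) + 3 M_{(0,1)}(χ) + 2 M_{(1,0)}(χ) + 6 M_{(1,2)}(χ) + 6 M_{(1,1)}(χ)], and G := (1/(9w⁴)) [M_{(0,0)}(χ)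 + 3 M_{(2,0)}(χ) + 3 M_{(0,2)}(χ) + 3 M_{(0,1)}(χ) + 3 M_{(1,0)}(χ) + 9 M_{(2,2)}(χ) + 9 M_{(1,2)}(χ) + 9 M_{(2,1)}(χ) + 9 M_{(1,1)}(χ)]. -/

import Mathlib

open MeasureTheory Filter
open scoped ENNReal BigOperators Topology

noncomputable def absMoment (χ : ℝ × ℝ → ℝ) (p₁ p₂ : ℕ) : ℝ≥0∞ :=
  ⨆ u : ℝ, ⨆ v : ℝ, ∑' k : ℤ, ∑' j : ℤ,
    ENNReal.ofReal (|χ (u - (k : ℝ), v - (j : ℝ))| * |u - (k : ℝ)| ^ p₁ * |v - (j : ℝ)| ^ p₂)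

noncomputable def Mmoment (χ : ℝ × ℝ → ℝ) (η : ℕ) : ℝ≥0∞ :=
  ⨆ p : {p : ℕ × ℕ // p.1 + p.2 = η}, absMoment χ p.1.1 p.1.2

def PartitionOfUnity2 (χ : ℝ × ℝ → ℝ) : Prop :=
  ∀ u v : ℝ, ∑' k : ℤ, ∑' j : ℤ, χ (u - (k : ℝ), v - (j : ℝ)) = 1

def MomentCondition (χ : ℝ × ℝ → ℝ) (r : ℕ) (c : ℝ) : Prop :=
  (∀ u v : ℝ, ∀ p₁ p₂ : ℕ, 1 ≤ p₁ + p₂ → p₁ + p₂ ≤ r - 1 →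
    ∑' k : ℤ, ∑' j : ℤ, χ (u - (k : ℝ), v - (j : ℝ)) * (u - (k : ℝ)) ^ p₁ * (v - (j : ℝ)) ^ p₂ = 0) ∧
  (∀ u v : ℝ, ∀ p₁ p₂ : ℕ, p₁ + p₂ = r →
    ∑' k : ℤ, ∑' j : ℤ, χ (u - (k : ℝ), v - (j : ℝ)) * (u - (k : ℝ)) ^ p₁ * (v - (j : ℝ)) ^ p₂ = c)

noncomputable def Gop (χ : ℝ × ℝ → ℝ) (w : ℝ) (f : ℝ × ℝ → ℝ) (x y : ℝ) : ℝ :=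
  ∑' k : ℤ, ∑' j : ℤ, χ (w * x - (k : ℝ), w * y - (j : ℝ)) * f ((k : ℝ) / w, (j : ℝ) / w)

noncomputable def Sop (χ : ℝ × ℝ → ℝ) (w : ℝ) (f : ℝ × ℝ → ℝ) (x y : ℝ) : ℝ :=
  ∑' k : ℤ, ∑' j : ℤ, χ (w * x - (k : ℝ), w * y - (j : ℝ)) *
    (w ^ 2 * ∫ u in ((k : ℝ) / w)..(((k : ℝ) + 1) / w),
      ∫ v in ((j : ℝ) / w)..(((j : ℝ) + 1) / w), f (u, v))

noncomputable def pX (f : ℝ × ℝ → ℝ) : ℝ × ℝ → ℝ := fun p => deriv (fun t => f (t, p.2)) p.1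
noncomputable def pY (f : ℝ × ℝ → ℝ) : ℝ × ℝ → ℝ := fun p => deriv (fun t => f (p.1, t)) p.2
noncomputable def pd (f : ℝ × ℝ → ℝ) (i j : ℕ) : ℝ × ℝ → ℝ := pX^[i] (pY^[j] f)

noncomputable def supNorm (g : ℝ × ℝ → ℝ) : ℝ := ⨆ p : ℝ × ℝ, |g p|

def mixedDiff (f : ℝ × ℝ → ℝ) (u v x y : ℝ) : ℝ := f (x, y) - f (x, v) - f (u, y) + f (u, v)

def BContinuous (f : ℝ × ℝ → ℝ) : Prop :=
  ∀ x₀ y₀ : ℝ, Tendsto (fun p : ℝ × ℝ => mixedDiff f x₀ y₀ p.1 p.2) (nhds (x₀, y₀)) (nhds 0)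

noncomputable def omegaB (f : ℝ × ℝ → ℝ) (δ₁ δ₂ : ℝ) : ℝ :=
  sSup {t : ℝ | ∃ x y u v : ℝ, |x - u| < δ₁ ∧ |y - v| < δ₂ ∧ t = |mixedDiff f u v x y|}

noncomputable def Kop (χ : ℝ × ℝ → ℝ) (w : ℝ) (f : ℝ × ℝ → ℝ) (x y : ℝ) : ℝ :=
  Sop χ w (fun p => f (p.1, y) + f (x, p.2) - f (p.1, p.2)) x y

/-- f is B-differentiable at (x₀, y₀) with B-derivative d. -/
def BDifferentiableAt (f : ℝ × ℝ → ℝ) (x₀ y₀ d : ℝ) : Prop :=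
  Tendsto (fun p : ℝ × ℝ => mixedDiff f x₀ y₀ p.1 p.2 / ((p.1 - x₀) * (p.2 - y₀)))
    (nhdsWithin (x₀, y₀) {p : ℝ × ℝ | p.1 ≠ x₀ ∧ p.2 ≠ y₀}) (nhds d)

theorem mixedDiff_eq_zero_of_fst_eq (f : ℝ × ℝ → ℝ) (a b d : ℝ) : mixedDiff f a b a d = 0 := by
  simp [mixedDiff]

theorem mixedDiff_eq_zero_of_snd_eq (f : ℝ × ℝ → ℝ) (a b c : ℝ) : mixedDiff f a b c b = 0 := by
  simp [mixedDiff]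

/-- Near a point of B-differentiability, the mixed difference is controlled by any constant
exceeding the absolute value of the B-derivative. -/
theorem BDifferentiableAt.exists_abs_mixedDiff_le {f : ℝ × ℝ → ℝ} {ξ η d C : ℝ}
    (h : BDifferentiableAt f ξ η d) (hC : |d| < C) :
    ∃ ε > 0, ∀ s t : ℝ, |s - ξ| < ε → |t - η| < ε →
      |mixedDiff f ξ η s t| ≤ C * (|s - ξ| * |t - η|) := by
  have h1 := h.abs.eventually_lt_const hC
  rw [eventually_nhdsWithin_iff, Metric.eventually_nhds_iff] at h1
  obtain ⟨ε, hε, H⟩ := h1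
  refine ⟨ε, hε, fun s t hs ht => ?_⟩
  by_cases hsξ : s = ξ
  · subst hsξ
    simp [mixedDiff_eq_zero_of_fst_eq]
  by_cases htη : t = η
  · subst htη
    simp [mixedDiff_eq_zero_of_snd_eq]
  have h2 := H (y := (s, t)) (by simp [Prod.dist_eq, Real.dist_eq, hs, ht]) ⟨hsξ, htη⟩
  have hpos : 0 < |s - ξ| * |t - η| :=
    mul_pos (abs_pos.2 (sub_ne_zero.2 hsξ)) (abs_pos.2 (sub_ne_zero.2 htη))
  rw [abs_div, abs_mul, div_lt_iff₀ hpos] at h2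
  exact h2.le

/-- On small rectangles containing a point of B-differentiability, the mixed difference is at most
a constant times the area. -/
theorem BDifferentiableAt.exists_abs_mixedDiff_le_area {f : ℝ × ℝ → ℝ} {ξ η d C : ℝ}
    (h : BDifferentiableAt f ξ η d) (hC : |d| < C) :
    ∃ ε > 0, ∀ a b c e : ℝ, a ≤ ξ → ξ ≤ c → b ≤ η → η ≤ e → c - a < ε → e - b < ε →
      |mixedDiff f a b c e| ≤ C * ((c - a) * (e - b)) := by
  obtain ⟨ε, hε, H⟩ := h.exists_abs_mixedDiff_le hC
  refine ⟨ε, hε, fun a b c e ha hc hb he hca heb => ?_⟩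
  have e1 : |a - ξ| = ξ - a := by rw [abs_sub_comm]; exact abs_of_nonneg (by linarith)
  have e2 : |c - ξ| = c - ξ := abs_of_nonneg (by linarith)
  have e3 : |b - η| = η - b := by rw [abs_sub_comm]; exact abs_of_nonneg (by linarith)
  have e4 : |e - η| = e - η := abs_of_nonneg (by linarith)
  have h1 := H c e (by linarith) (by linarith)
  have h2 := H a e (by linarith) (by linarith)
  have h3 := H c b (by linarith) (by linarith)
  have h4 := H a b (by linarith) (by linarith)
  rw [e1, e3] at h4
  rw [e2, e4] at h1
  rw [e1, e4] at h2
  rw [e2, e3] at h3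
  have key : mixedDiff f a b c e = mixedDiff f ξ η c e - mixedDiff f ξ η a e
      - mixedDiff f ξ η c b + mixedDiff f ξ η a b := by
    simp only [mixedDiff]; ring
  rw [key]
  have g1 := abs_le.1 h1
  have g2 := abs_le.1 h2
  have g3 := abs_le.1 h3
  have g4 := abs_le.1 h4
  rw [abs_le]
  constructor <;> linarith

/-- One bisection step: if the mixed difference of a rectangle is large compared with its area,
then so is that of one of its four quarters. -/
theorem exists_quarter_mixedDiff_gt (f : ℝ × ℝ → ℝ) {C a b h k : ℝ}
    (H : C * ((2 * h) * (2 * k)) < |mixedDiff f a b (a + 2 * h) (b + 2 * k)|) :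
    ∃ a' b' : ℝ, (a' = a ∨ a' = a + h) ∧ (b' = b ∨ b' = b + k) ∧
      C * (h * k) < |mixedDiff f a' b' (a' + h) (b' + k)| := by
  by_contra! hcon
  have h1 := hcon a b (.inl rfl) (.inl rfl)
  have h2 := hcon a (b + k) (.inl rfl) (.inr rfl)
  have h3 := hcon (a + h) b (.inr rfl) (.inl rfl)
  have h4 := hcon (a + h) (b + k) (.inr rfl) (.inr rfl)
  have key : mixedDiff f a b (a + 2 * h) (b + 2 * k) = mixedDiff f a b (a + h) (b + k)
      + mixedDiff f a (b + k) (a + h) (b + k + k) + mixedDiff f (a + h) b (a + h + h) (b + k)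
      + mixedDiff f (a + h) (b + k) (a + h + h) (b + k + k) := by
    rw [show a + 2 * h = a + h + h by ring, show b + 2 * k = b + k + k by ring]
    simp only [mixedDiff]; ring
  rw [key] at H
  have g1 := abs_le.1 h1
  have g2 := abs_le.1 h2
  have g3 := abs_le.1 h3
  have g4 := abs_le.1 h4
  refine absurd H (not_lt.2 ?_)
  rw [abs_le]
  constructor <;> linarith

/-- A sequence of nested intervals of lengths `h / 2 ^ n`, with left endpoints `a n`, has a common
point. -/
theorem exists_mem_nested_halves {a : ℕ → ℝ} {h : ℝ} (hh : 0 ≤ h)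
    (ha : ∀ n, a (n + 1) = a n ∨ a (n + 1) = a n + h / 2 ^ (n + 1)) :
    ∃ ξ, ∀ n, a n ≤ ξ ∧ ξ ≤ a n + h / 2 ^ n := by
  have hpos : ∀ n : ℕ, 0 ≤ h / 2 ^ n := fun n => by positivity
  have hhalf : ∀ n : ℕ, h / 2 ^ n = h / 2 ^ (n + 1) + h / 2 ^ (n + 1) := fun n => by
    rw [pow_succ]; field_simp; norm_num
  have hmono : Monotone a := monotone_nat_of_le_succ fun n => by
    rcases ha n with e | e <;> linarith [hpos (n + 1)]
  have hanti : Antitone fun n => a n + h / 2 ^ n := antitone_nat_of_succ_le fun n => by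
    rcases ha n with e | e <;> linarith [hpos (n + 1), hhalf n]
  have := hmono.ciSup_mem_iInter_Icc_of_antitone hanti fun n => by
    simpa using hpos n
  exact ⟨_, fun n => Set.mem_iInter.1 this n⟩

theorem abs_mixedDiff_le_of_abs_lt_of_nonneg {f D : ℝ × ℝ → ℝ}
    (hD : ∀ x y : ℝ, BDifferentiableAt f x y (D (x, y))) {C : ℝ} (hC : ∀ p, |D p| < C)
    (a b : ℝ) {h k : ℝ} (hh : 0 ≤ h) (hk : 0 ≤ k) :
    |mixedDiff f a b (a + h) (b + k)| ≤ C * (h * k) := by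
  by_contra! hbad
  have hhalf : ∀ (r : ℝ) (n : ℕ), r / 2 ^ n = 2 * (r / 2 ^ (n + 1)) := fun r n => by
    rw [pow_succ]; field_simp
  let Bad : ℕ → ℝ × ℝ → Prop := fun n p =>
    C * ((h / 2 ^ n) * (k / 2 ^ n)) < |mixedDiff f p.1 p.2 (p.1 + h / 2 ^ n) (p.2 + k / 2 ^ n)|
  have step : ∀ (n : ℕ) (p : {p // Bad n p}), ∃ q : {q // Bad (n + 1) q},
      (q.1.1 = p.1.1 ∨ q.1.1 = p.1.1 + h / 2 ^ (n + 1)) ∧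
      (q.1.2 = p.1.2 ∨ q.1.2 = p.1.2 + k / 2 ^ (n + 1)) := by
    rintro n ⟨⟨a, b⟩, hp⟩
    simp only [Bad, hhalf h n, hhalf k n] at hp
    obtain ⟨a', b', ha', hb', H⟩ := exists_quarter_mixedDiff_gt f hp
    exact ⟨⟨(a', b'), H⟩, ha', hb'⟩
  choose next hnext using step
  let s : (n : ℕ) → {p // Bad n p} := fun n =>
    Nat.rec (motive := fun n => {p // Bad n p}) ⟨(a, b), by simpa [Bad] using hbad⟩ next n
  obtain ⟨ξ, hξ⟩ := exists_mem_nested_halves (a := fun n => (s n).1.1) hh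
    fun n => (hnext n (s n)).1
  obtain ⟨η, hη⟩ := exists_mem_nested_halves (a := fun n => (s n).1.2) hk
    fun n => (hnext n (s n)).2
  obtain ⟨ε, hε, H⟩ := (hD ξ η).exists_abs_mixedDiff_le_area (hC (ξ, η))
  have hlim : ∀ r : ℝ, ∀ᶠ n : ℕ in atTop, r / 2 ^ n < ε := fun r => by
    have := (tendsto_const_nhds (x := r)).div_atTop
      (tendsto_pow_atTop_atTop_of_one_lt (one_lt_two (α := ℝ)))
    exact this.eventually_lt_const hε
  obtain ⟨n, hn1, hn2⟩ := ((hlim h).and (hlim k)).exists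
  have h1 := H _ _ _ _ (hξ n).1 (hξ n).2 (hη n).1 (hη n).2 (by simpa using hn1)
    (by simpa using hn2)
  simp only [add_sub_cancel_left] at h1
  exact absurd (s n).2 (not_lt.2 h1)

/-- Mean value inequality for B-differentiable functions. -/
theorem abs_mixedDiff_le_of_abs_le {f D : ℝ × ℝ → ℝ}
    (hD : ∀ x y : ℝ, BDifferentiableAt f x y (D (x, y))) {C : ℝ} (hC : ∀ p, |D p| ≤ C)
    (a b c e : ℝ) : |mixedDiff f a b c e| ≤ C * (|c - a| * |e - b|) := by
  have main : ∀ a b c e : ℝ, a ≤ c → b ≤ e →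
      |mixedDiff f a b c e| ≤ C * ((c - a) * (e - b)) := by
    intro a b c e hac hbe
    have hlim : Tendsto (fun ε : ℝ => (C + ε) * ((c - a) * (e - b))) (𝓝[>] 0)
        (𝓝 ((C + 0) * ((c - a) * (e - b)))) :=
      (Continuous.tendsto (by fun_prop) 0).mono_left nhdsWithin_le_nhds
    rw [add_zero] at hlim
    refine ge_of_tendsto hlim ?_
    filter_upwards [self_mem_nhdsWithin] with ε hε
    have := abs_mixedDiff_le_of_abs_lt_of_nonneg hD
      (fun p => (hC p).trans_lt (lt_add_of_pos_right C hε)) a b (sub_nonneg.2 hac)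
      (sub_nonneg.2 hbe)
    simpa using this
  have s1 : ∀ a b c e : ℝ, |mixedDiff f a b c e| = |mixedDiff f c b a e| := fun a b c e => by
    rw [← abs_neg]; congr 1; simp only [mixedDiff]; ring
  have s2 : ∀ a b c e : ℝ, |mixedDiff f a b c e| = |mixedDiff f a e c b| := fun a b c e => by
    rw [← abs_neg]; congr 1; simp only [mixedDiff]; ring
  have main' : ∀ a b c e : ℝ, a ≤ c →
      |mixedDiff f a b c e| ≤ C * ((c - a) * |e - b|) := by
    intro a b c e hac
    rcases le_total b e with h | h
    · rw [abs_of_nonneg (sub_nonneg.2 h)]; exact main a b c e hac h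
    · rw [abs_sub_comm, abs_of_nonneg (sub_nonneg.2 h), s2]; exact main a e c b hac h
  rcases le_total a c with h | h
  · rw [abs_of_nonneg (sub_nonneg.2 h)]; exact main' a b c e h
  · rw [abs_sub_comm c a, abs_of_nonneg (sub_nonneg.2 h), s1]; exact main' c b a e h

/-- A bound of the mixed differences by a multiple of the area makes them jointly continuous in
one corner. -/
theorem continuous_mixedDiff {f : ℝ × ℝ → ℝ} {C : ℝ}
    (hC : ∀ a b c e, |mixedDiff f a b c e| ≤ C * (|c - a| * |e - b|)) (x y : ℝ) :
    Continuous fun p : ℝ × ℝ => mixedDiff f p.1 p.2 x y := by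
  rw [continuous_iff_continuousAt]
  intro p
  rw [ContinuousAt, tendsto_iff_dist_tendsto_zero]
  have hlim : Tendsto (fun q : ℝ × ℝ => C * (|p.1 - q.1| * |y - p.2|) +
      C * (|x - q.1| * |p.2 - q.2|)) (𝓝 p) (𝓝 (C * (|p.1 - p.1| * |y - p.2|) +
      C * (|x - p.1| * |p.2 - p.2|))) := Continuous.tendsto (by fun_prop) p
  simp only [sub_self, abs_zero, zero_mul, mul_zero, add_zero] at hlim
  refine squeeze_zero (fun _ => dist_nonneg) (fun q => ?_) hlim
  have key : mixedDiff f q.1 q.2 x y - mixedDiff f p.1 p.2 x y =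
      mixedDiff f q.1 p.2 p.1 y + mixedDiff f q.1 q.2 x p.2 := by
    simp only [mixedDiff]; ring
  rw [Real.dist_eq, key]
  exact (abs_add_le _ _).trans (add_le_add (hC _ _ _ _) (hC _ _ _ _))

theorem integral_abs_sub_cell_le {w : ℝ} (hw : 0 < w) (x k : ℝ) :
    ∫ u in (k / w)..((k + 1) / w), |x - u| ≤ (1 + 2 * |w * x - k|) / (2 * w ^ 2) := by
  have hle : k / w ≤ (k + 1) / w := by gcongr; linarith
  have h1 : ∫ u in (k / w)..((k + 1) / w), |x - u| ≤
      ∫ u in (k / w)..((k + 1) / w), (|x - k / w| + (u - k / w)) := by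
    refine intervalIntegral.integral_mono_on hle
      (Continuous.intervalIntegrable (by fun_prop) _ _)
      (Continuous.intervalIntegrable (by fun_prop) _ _) fun u hu => ?_
    have := abs_sub_le x (k / w) u
    rwa [abs_sub_comm (k / w) u, abs_of_nonneg (sub_nonneg.2 hu.1)] at this
  refine h1.trans (le_of_eq ?_)
  have h2 : |x - k / w| = |w * x - k| / w := by
    rw [show x - k / w = (w * x - k) / w by field_simp, abs_div, abs_of_pos hw]
  rw [h2, intervalIntegral.integral_add (by simp)
      (Continuous.intervalIntegrable (by fun_prop) _ _),
    intervalIntegral.integral_sub (by simp) (by simp)]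
  simp only [intervalIntegral.integral_const, integral_id, smul_eq_mul]
  field_simp
  ring

/-- The mean of a function dominated by `C * |x - u| * |y - v|` over a cell of the lattice. -/
theorem abs_cell_mean_le {F : ℝ × ℝ → ℝ} {C w x y : ℝ} (hw : 0 < w) (hC0 : 0 ≤ C)
    (hF : ∀ u v, |F (u, v)| ≤ C * (|x - u| * |y - v|)) (k j : ℝ) :
    |w ^ 2 * ∫ u in (k / w)..((k + 1) / w), ∫ v in (j / w)..((j + 1) / w), F (u, v)| ≤
      C * (1 / (4 * w ^ 2) * ((1 + 2 * |w * x - k|) * (1 + 2 * |w * y - j|))) := by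
  have hk : k / w ≤ (k + 1) / w := by gcongr; linarith
  have hj : j / w ≤ (j + 1) / w := by gcongr; linarith
  set A := (1 + 2 * |w * x - k|) / (2 * w ^ 2) with hA
  set B := (1 + 2 * |w * y - j|) / (2 * w ^ 2) with hB
  have hB0 : 0 ≤ B := by positivity
  have inner : ∀ u, ‖∫ v in (j / w)..((j + 1) / w), F (u, v)‖ ≤ C * B * |x - u| := fun u => by
    calc ‖∫ v in (j / w)..((j + 1) / w), F (u, v)‖
        ≤ ∫ v in (j / w)..((j + 1) / w), C * |x - u| * |y - v| :=
          intervalIntegral.norm_integral_le_of_norm_le hj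
            (.of_forall fun v _ => by rw [Real.norm_eq_abs, mul_assoc]; exact hF u v)
            (Continuous.intervalIntegrable (by fun_prop) _ _)
      _ = C * |x - u| * ∫ v in (j / w)..((j + 1) / w), |y - v| :=
          intervalIntegral.integral_const_mul _ _
      _ ≤ C * |x - u| * B := by
          gcongr
          exact integral_abs_sub_cell_le hw y j
      _ = C * B * |x - u| := by ring
  have outer : |∫ u in (k / w)..((k + 1) / w), ∫ v in (j / w)..((j + 1) / w), F (u, v)| ≤
      C * B * A := by
    calc ‖∫ u in (k / w)..((k + 1) / w), ∫ v in (j / w)..((j + 1) / w), F (u, v)‖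
        ≤ ∫ u in (k / w)..((k + 1) / w), C * B * |x - u| :=
          intervalIntegral.norm_integral_le_of_norm_le hk
            (.of_forall fun u _ => inner u) (Continuous.intervalIntegrable (by fun_prop) _ _)
      _ = C * B * ∫ u in (k / w)..((k + 1) / w), |x - u| :=
          intervalIntegral.integral_const_mul _ _
      _ ≤ C * B * A := by
          gcongr
          exact integral_abs_sub_cell_le hw x k
  rw [abs_mul, abs_of_pos (by positivity : 0 < w ^ 2)]
  refine (mul_le_mul_of_nonneg_left outer (by positivity)).trans (le_of_eq ?_)
  rw [hA, hB]
  field_simp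
  ring

/-- The mean over a cell of the lattice of a constant minus a continuous function. -/
theorem cell_mean_const_sub {F : ℝ × ℝ → ℝ} (hF : Continuous F) {w : ℝ} (hw : 0 < w)
    (c k j : ℝ) :
    w ^ 2 * ∫ u in (k / w)..((k + 1) / w), ∫ v in (j / w)..((j + 1) / w), (c - F (u, v)) =
      c - w ^ 2 * ∫ u in (k / w)..((k + 1) / w), ∫ v in (j / w)..((j + 1) / w), F (u, v) := by
  have inner : ∀ u, ∫ v in (j / w)..((j + 1) / w), (c - F (u, v)) =
      c / w - ∫ v in (j / w)..((j + 1) / w), F (u, v) := fun u => by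
    rw [intervalIntegral.integral_sub (by simp)
      (Continuous.intervalIntegrable (by fun_prop) _ _), intervalIntegral.integral_const,
      smul_eq_mul]
    congr 1
    field_simp
    ring
  have hcont : Continuous fun u => ∫ v in (j / w)..((j + 1) / w), F (u, v) :=
    intervalIntegral.continuous_parametric_intervalIntegral_of_continuous' (by fun_prop) _ _
  simp only [inner]
  rw [intervalIntegral.integral_sub (by simp) (hcont.intervalIntegrable _ _),
    intervalIntegral.integral_const, smul_eq_mul, mul_sub]
  congr 1
  field_simp
  ring

theorem summable_and_tsum_le_absMoment {χ : ℝ × ℝ → ℝ} {p₁ p₂ : ℕ} (h : absMoment χ p₁ p₂ < ⊤)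
    (u v : ℝ) :
    Summable (fun q : ℤ × ℤ => |χ (u - q.1, v - q.2)| * |u - q.1| ^ p₁ * |v - q.2| ^ p₂) ∧
      ∑' q : ℤ × ℤ, |χ (u - q.1, v - q.2)| * |u - q.1| ^ p₁ * |v - q.2| ^ p₂ ≤
        (absMoment χ p₁ p₂).toReal := by
  set m : ℤ × ℤ → ℝ := fun q => |χ (u - q.1, v - q.2)| * |u - q.1| ^ p₁ * |v - q.2| ^ p₂
  have hm0 : ∀ q, 0 ≤ m q := fun q => by positivity
  have hle : ∑' q, ENNReal.ofReal (m q) ≤ absMoment χ p₁ p₂ := by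
    rw [ENNReal.tsum_prod']
    exact le_iSup₂_of_le (f := fun u v : ℝ => ∑' k : ℤ, ∑' j : ℤ, ENNReal.ofReal
      (|χ (u - (k : ℝ), v - (j : ℝ))| * |u - (k : ℝ)| ^ p₁ * |v - (j : ℝ)| ^ p₂)) u v le_rfl
  have hs : Summable m := by
    have := ENNReal.summable_toReal (hle.trans_lt h).ne
    simpa only [ENNReal.toReal_ofReal (hm0 _)] using this
  refine ⟨hs, ?_⟩
  rw [← ENNReal.ofReal_tsum_of_nonneg hm0 hs] at hle
  exact (ENNReal.ofReal_le_iff_le_toReal h.ne).1 hle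

/-- The weights of the cell means, summed against the kernel, in terms of absolute moments. -/
theorem summable_and_tsum_weight_le {χ : ℝ × ℝ → ℝ}
    (hfin : ∀ p₁ p₂ : ℕ, p₁ ≤ 1 → p₂ ≤ 1 → absMoment χ p₁ p₂ < ⊤) (u v : ℝ) :
    Summable (fun q : ℤ × ℤ =>
      |χ (u - q.1, v - q.2)| * ((1 + 2 * |u - q.1|) * (1 + 2 * |v - q.2|))) ∧
    ∑' q : ℤ × ℤ, |χ (u - q.1, v - q.2)| * ((1 + 2 * |u - q.1|) * (1 + 2 * |v - q.2|)) ≤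
      (absMoment χ 0 0).toReal + 2 * (absMoment χ 1 0).toReal +
        2 * (absMoment χ 0 1).toReal + 4 * (absMoment χ 1 1).toReal := by
  obtain ⟨s00, t00⟩ := summable_and_tsum_le_absMoment (hfin 0 0 (by simp) (by simp)) u v
  obtain ⟨s10, t10⟩ := summable_and_tsum_le_absMoment (hfin 1 0 (by simp) (by simp)) u v
  obtain ⟨s01, t01⟩ := summable_and_tsum_le_absMoment (hfin 0 1 (by simp) (by simp)) u v
  obtain ⟨s11, t11⟩ := summable_and_tsum_le_absMoment (hfin 1 1 (by simp) (by simp)) u v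
  have hsum := ((s00.hasSum.add (s10.hasSum.mul_left 2)).add (s01.hasSum.mul_left 2)).add
    (s11.hasSum.mul_left 4)
  have hfun : (fun q : ℤ × ℤ =>
      |χ (u - q.1, v - q.2)| * ((1 + 2 * |u - q.1|) * (1 + 2 * |v - q.2|))) = fun q : ℤ × ℤ =>
      |χ (u - q.1, v - q.2)| * |u - q.1| ^ 0 * |v - q.2| ^ 0 +
      2 * (|χ (u - q.1, v - q.2)| * |u - q.1| ^ 1 * |v - q.2| ^ 0) +
      2 * (|χ (u - q.1, v - q.2)| * |u - q.1| ^ 0 * |v - q.2| ^ 1) +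
      4 * (|χ (u - q.1, v - q.2)| * |u - q.1| ^ 1 * |v - q.2| ^ 1) := by
    funext q; ring
  rw [← hfun] at hsum
  refine ⟨hsum.summable, ?_⟩
  rw [hsum.tsum_eq]
  linarith

theorem omegaB_nonneg (g : ℝ × ℝ → ℝ) (δ₁ δ₂ : ℝ) : 0 ≤ omegaB g δ₁ δ₂ :=
  Real.sSup_nonneg <| by rintro _ ⟨x, y, u, v, -, -, rfl⟩; exact abs_nonneg _

theorem supNorm_nonneg (g : ℝ × ℝ → ℝ) : 0 ≤ supNorm g :=
  Real.iSup_nonneg fun _ => abs_nonneg _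

theorem abs_le_supNorm {g : ℝ × ℝ → ℝ} (hg : ∃ C : ℝ, ∀ p, |g p| ≤ C) (p : ℝ × ℝ) :
    |g p| ≤ supNorm g := by
  obtain ⟨C, hC⟩ := hg
  exact le_ciSup (f := fun p => |g p|) ⟨C, by rintro _ ⟨q, rfl⟩; exact hC q⟩ p

/-- The error of the GBS operator when the mixed differences are bounded by a multiple of the
area. -/
theorem abs_Kop_sub_le {χ : ℝ × ℝ → ℝ} (hpart : PartitionOfUnity2 χ)
    (hfin : ∀ p₁ p₂ : ℕ, p₁ ≤ 1 → p₂ ≤ 1 → absMoment χ p₁ p₂ < ⊤) {f : ℝ × ℝ → ℝ} {C : ℝ}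
    (hC0 : 0 ≤ C) (hC : ∀ a b c e, |mixedDiff f a b c e| ≤ C * (|c - a| * |e - b|))
    {w : ℝ} (hw : 0 < w) (x y : ℝ) :
    |Kop χ w f x y - f (x, y)| ≤ C * (1 / (4 * w ^ 2) * ((absMoment χ 0 0).toReal +
      2 * (absMoment χ 1 0).toReal + 2 * (absMoment χ 0 1).toReal +
      4 * (absMoment χ 1 1).toReal)) := by
  set F : ℝ × ℝ → ℝ := fun p => mixedDiff f p.1 p.2 x y with hF
  have hFc : Continuous F := continuous_mixedDiff hC x y
  set a : ℤ × ℤ → ℝ := fun q => χ (w * x - q.1, w * y - q.2)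
  set J : ℤ × ℤ → ℝ := fun q => w ^ 2 * ∫ u in ((q.1 : ℝ) / w)..(((q.1 : ℝ) + 1) / w),
      ∫ v in ((q.2 : ℝ) / w)..(((q.2 : ℝ) + 1) / w), F (u, v)
  have hK : Kop χ w f x y = ∑' k : ℤ, ∑' j : ℤ, a (k, j) * (f (x, y) - J (k, j)) := by
    have hg : (fun p : ℝ × ℝ => f (p.1, y) + f (x, p.2) - f (p.1, p.2)) =
        fun p => f (x, y) - F p := by
      funext p
      simp only [hF, mixedDiff]
      ring
    rw [Kop, hg]
    refine tsum_congr fun k => tsum_congr fun j => ?_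
    rw [cell_mean_const_sub hFc hw]
  obtain ⟨sW, tW⟩ := summable_and_tsum_weight_le hfin (w * x) (w * y)
  have sa : Summable a := by
    have := (summable_and_tsum_le_absMoment (hfin 0 0 (by simp) (by simp)) (w * x) (w * y)).1
    simp only [pow_zero, mul_one] at this
    exact this.of_abs
  have hbound : ∀ q : ℤ × ℤ, ‖a q * J q‖ ≤ C * (1 / (4 * w ^ 2)) *
      (|a q| * ((1 + 2 * |w * x - q.1|) * (1 + 2 * |w * y - q.2|))) := fun q => by
    rw [norm_mul, Real.norm_eq_abs, Real.norm_eq_abs]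
    have := mul_le_mul_of_nonneg_left (abs_cell_mean_le (F := F) hw hC0
      (fun u v => hC u v x y) q.1 q.2) (abs_nonneg (a q))
    exact this.trans (le_of_eq (by ring))
  have sW' := sW.mul_left (C * (1 / (4 * w ^ 2)))
  have saJ : Summable fun q => a q * J q := Summable.of_norm_bounded sW' hbound
  have hone : ∑' q, a q = 1 := by
    rw [sa.tsum_prod]; exact hpart _ _
  have hsum : HasSum (fun q => a q * (f (x, y) - J q)) (1 * f (x, y) - ∑' q, a q * J q) := by
    have := (sa.hasSum.mul_right (f (x, y))).sub saJ.hasSum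
    rw [hone] at this
    simpa only [mul_sub] using this
  rw [hK, ← hsum.summable.tsum_prod, hsum.tsum_eq, one_mul, sub_sub_cancel_left, abs_neg]
  calc |∑' q, a q * J q| ≤ ∑' q : ℤ × ℤ, C * (1 / (4 * w ^ 2)) *
        (|a q| * ((1 + 2 * |w * x - q.1|) * (1 + 2 * |w * y - q.2|))) :=
        tsum_of_norm_bounded sW'.hasSum hbound
    _ ≤ _ := by
        rw [tsum_mul_left, mul_assoc]
        gcongr

/-- rate of approximation of the GBS operator for B-differentiable functions. -/
theorem statement9 (χ : ℝ × ℝ → ℝ) (hχc : Continuous χ) (hχb : ∃ C : ℝ, ∀ p, |χ p| ≤ C)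
    (hpart : PartitionOfUnity2 χ)
    (hfin : ∀ p₁ p₂ : ℕ, p₁ ≤ 2 → p₂ ≤ 2 → absMoment χ p₁ p₂ < ⊤)
    (f : ℝ × ℝ → ℝ) (hfb : ∃ C : ℝ, ∀ p, |f p| ≤ C) (hfB : BContinuous f)
    (DBf : ℝ × ℝ → ℝ) (hDB : ∀ x y : ℝ, BDifferentiableAt f x y (DBf (x, y)))
    (hDBb : ∃ C : ℝ, ∀ p, |DBf p| ≤ C)
    (w : ℝ) (hw : 0 < w) (x y : ℝ) (δ₁ δ₂ : ℝ) (hδ₁ : 0 < δ₁) (hδ₂ : 0 < δ₂) :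
    |Kop χ w f x y - f (x, y)| ≤
      ((1 / (4 * w ^ 2)) * ((absMoment χ 0 0).toReal + 2 * (absMoment χ 1 0).toReal +
          2 * (absMoment χ 0 1).toReal + 4 * (absMoment χ 1 1).toReal)) *
        (3 * supNorm DBf + omegaB DBf δ₁ δ₂) +
      ((1 / (6 * w ^ 3)) * ((absMoment χ 0 0).toReal + 3 * (absMoment χ 2 0).toReal +
          3 * (absMoment χ 1 0).toReal + 2 * (absMoment χ 0 1).toReal +
          6 * (absMoment χ 2 1).toReal + 6 * (absMoment χ 1 1).toReal) / δ₁ +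
        (1 / (6 * w ^ 3)) * ((absMoment χ 0 0).toReal + 3 * (absMoment χ 0 2).toReal +
          3 * (absMoment χ 0 1).toReal + 2 * (absMoment χ 1 0).toReal +
          6 * (absMoment χ 1 2).toReal + 6 * (absMoment χ 1 1).toReal) / δ₂ +
        (1 / (9 * w ^ 4)) * ((absMoment χ 0 0).toReal + 3 * (absMoment χ 2 0).toReal +
          3 * (absMoment χ 0 2).toReal + 3 * (absMoment χ 0 1).toReal +
          3 * (absMoment χ 1 0).toReal + 9 * (absMoment χ 2 2).toReal +
          9 * (absMoment χ 1 2).toReal + 9 * (absMoment χ 2 1).toReal +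
          9 * (absMoment χ 1 1).toReal) / (δ₁ * δ₂)) *
        omegaB DBf δ₁ δ₂ := by
  have hsup := supNorm_nonneg DBf
  have hω := omegaB_nonneg DBf δ₁ δ₂
  have main := abs_Kop_sub_le hpart
    (fun p₁ p₂ h₁ h₂ => hfin p₁ p₂ (h₁.trans one_le_two) (h₂.trans one_le_two)) hsup
    (abs_mixedDiff_le_of_abs_le hDB (abs_le_supNorm hDBb)) hw x y
  refine main.trans ?_
  rw [mul_comm]
  refine le_add_of_le_of_nonneg ?_ (by positivity)
  gcongr
  linarith
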